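/- Let Ω be a nonempty set, E_0 : Ω → ℝ, and (ψ_j)_{j≥1} bounded real-valued functions on Ω whose sup-norms b_j := sup_{x∈Ω}|ψ_j(x)| form a nonincreasing sequence (b_j ≥ b_{j+1} for all j) satisfying ∑_{j=1}^∞ b_j^p < ∞ for some 0 < p < 1. For y = (y_j)_{j≥1} with |y_j| ≤ 1/2, define E(x,y) = E_0(x) + ∑_{j=1}^∞ y_j ψ_j(x), and let y_s = (y_1,…,y_s,0,0,…). Then for every s ≥ 1 and every x ∈ Ω, |E(x,y) − E(x,y_s)| ≤ (p/(2(1−p))) · (∑_{j=1}^∞ b_j^p)^{1/p} · s^{1−1/p}. -/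

import Mathlib

theorem kl_aux_step (a : ℝ) (ha : 1 < a) (n : ℕ) (hn : 1 ≤ n) :
    (a - 1) * ((n : ℝ) + 1) ^ (-a) ≤ (n : ℝ) ^ (1 - a) - ((n : ℝ) + 1) ^ (1 - a) := by
  have hn0 : (0 : ℝ) < n := by exact_mod_cast hn
  have hn1 : (0 : ℝ) < (n : ℝ) + 1 := by linarith
  have hx : (0 : ℝ) < n / (n + 1) := by positivity
  have hlog : Real.log ((n : ℝ) / (n + 1)) ≤ (n : ℝ) / (n + 1) - 1 := Real.log_le_sub_one_of_pos hx
  have e1 : (n : ℝ) / (n + 1) - 1 = -(1 / ((n : ℝ) + 1)) := by field_simp; ring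
  have hB : 1 + (a - 1) * (1 / ((n : ℝ) + 1)) ≤ ((n : ℝ) / (n + 1)) ^ (1 - a) := by
    rw [Real.rpow_def_of_pos hx]
    have := Real.add_one_le_exp (Real.log ((n : ℝ) / (n + 1)) * (1 - a))
    rw [e1] at hlog
    nlinarith
  have e2 : (n : ℝ) ^ (1 - a) = ((n : ℝ) + 1) ^ (1 - a) * ((n : ℝ) / (n + 1)) ^ (1 - a) := by
    rw [← Real.mul_rpow hn1.le hx.le]
    congr 1
    field_simp
  have e3 : ((n : ℝ) + 1) ^ (-a) = ((n : ℝ) + 1) ^ (1 - a) * (1 / ((n : ℝ) + 1)) := by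
    rw [show -a = (1 - a) - 1 by ring, Real.rpow_sub_one hn1.ne']
    ring
  have hpos : 0 < ((n : ℝ) + 1) ^ (1 - a) := Real.rpow_pos_of_pos hn1 _
  rw [e2, e3]
  have := mul_le_mul_of_nonneg_left hB hpos.le
  linarith

theorem kl_aux_sum (a : ℝ) (ha : 1 < a) (s : ℕ) (hs : 1 ≤ s) (N : ℕ) :
    (a - 1) * ∑ i ∈ Finset.range N, (((i + s : ℕ) : ℝ) + 1) ^ (-a) ≤
      (s : ℝ) ^ (1 - a) - ((N + s : ℕ) : ℝ) ^ (1 - a) := by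
  induction N with
  | zero => simp
  | succ N ih =>
    rw [Finset.sum_range_succ, mul_add]
    have := kl_aux_step a ha (N + s) (by omega)
    have e : ((N + 1 + s : ℕ) : ℝ) = ((N + s : ℕ) : ℝ) + 1 := by push_cast; ring
    rw [e]
    linarith

theorem kl_aux_bound (b : ℕ → ℝ) (hb0 : ∀ j, 0 ≤ b j) (hb : Antitone b) (p : ℝ) (hp0 : 0 < p)
    (hsum : Summable (fun j => b j ^ p)) (j : ℕ) :
    b j ≤ (∑' j, b j ^ p) ^ (1 / p) * ((j : ℝ) + 1) ^ (-(1 / p)) := by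
  have hj : (0 : ℝ) < (j : ℝ) + 1 := by positivity
  have h0 : ∀ i, 0 ≤ b i ^ p := fun i => Real.rpow_nonneg (hb0 i) p
  have h1 : ((j : ℝ) + 1) * b j ^ p ≤ ∑' j, b j ^ p := by
    calc ((j : ℝ) + 1) * b j ^ p = ∑ i ∈ Finset.range (j + 1), b j ^ p := by simp
      _ ≤ ∑ i ∈ Finset.range (j + 1), b i ^ p := by
        refine Finset.sum_le_sum fun i hi => ?_
        have hij : i ≤ j := by have := Finset.mem_range.1 hi; omega
        exact Real.rpow_le_rpow (hb0 j) (hb hij) hp0.le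
      _ ≤ _ := hsum.sum_le_tsum _ (fun i _ => h0 i)
  have h2 : b j ^ p ≤ (∑' j, b j ^ p) / ((j : ℝ) + 1) := by
    rw [le_div_iff₀ hj]; linarith
  have h3 := Real.rpow_le_rpow (h0 j) h2 (by positivity : 0 ≤ 1 / p)
  rw [← Real.rpow_mul (hb0 j), mul_one_div_cancel hp0.ne', Real.rpow_one,
    Real.div_rpow (tsum_nonneg h0) hj.le] at h3
  rw [Real.rpow_neg hj.le, ← div_eq_mul_inv]
  exact h3

/-- Suppose the sup-norms `b_j = sup_x |ψ_j x|` of the bounded functions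
`ψ_j` are nonincreasing and ℓ^p-summable for some `0 < p < 1`.  With
`E(x,y) = E₀(x) + ∑_j y_j ψ_j(x)` (`|y_j| ≤ 1/2`) and `y_s` the truncation keeping the
first `s` entries, for every `s ≥ 1` and every `x`:
`|E(x,y) − E(x,y_s)| ≤ (p/(2(1−p))) · (∑_j b_j^p)^{1/p} · s^{1−1/p}`. -/
theorem kl_truncation_error_rate
    {Ω : Type*} [Nonempty Ω]
    (E₀ : Ω → ℝ) (ψ : ℕ → Ω → ℝ)
    (hbdd : ∀ j : ℕ, BddAbove (Set.range fun x : Ω => |ψ j x|))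
    (p : ℝ) (hp0 : 0 < p) (hp1 : p < 1)
    (hmono : ∀ j : ℕ, (⨆ x : Ω, |ψ (j + 1) x|) ≤ ⨆ x : Ω, |ψ j x|)
    (hsum : Summable (fun j : ℕ => (⨆ x : Ω, |ψ j x|) ^ p))
    (y : ℕ → ℝ) (hy : ∀ j : ℕ, |y j| ≤ 1 / 2)
    (s : ℕ) (hs : 1 ≤ s) :
    ∀ x : Ω,
      |(E₀ x + ∑' j : ℕ, y j * ψ j x) -
        (E₀ x + ∑' j : ℕ, (if j < s then y j else 0) * ψ j x)| ≤
      (p / (2 * (1 - p))) * (∑' j : ℕ, (⨆ x : Ω, |ψ j x|) ^ p) ^ (1 / p) *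
        (s : ℝ) ^ (1 - 1 / p) := by
  intro x
  set b : ℕ → ℝ := fun j => ⨆ x : Ω, |ψ j x| with hbdef
  have hψ : ∀ j, |ψ j x| ≤ b j := fun j => le_ciSup (hbdd j) x
  have hb0 : ∀ j, 0 ≤ b j := fun j => (abs_nonneg _).trans (hψ j)
  have hb : Antitone b := antitone_nat_of_succ_le hmono
  have ha : 1 < 1 / p := by rw [lt_div_iff₀ hp0]; linarith
  have hbj := kl_aux_bound b hb0 hb p hp0 hsum
  change _ ≤ (p / (2 * (1 - p))) * (∑' j : ℕ, b j ^ p) ^ (1 / p) * (s : ℝ) ^ (1 - 1 / p)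
  set a := 1 / p with hadef
  set C := (∑' j : ℕ, b j ^ p) ^ a with hC
  have hC0 : 0 ≤ C := Real.rpow_nonneg (tsum_nonneg fun j => Real.rpow_nonneg (hb0 j) p) _
  have hterm : ∀ j, |y j * ψ j x| ≤ 1 / 2 * (C * ((j : ℝ) + 1) ^ (-a)) := by
    intro j
    rw [abs_mul]
    exact mul_le_mul (hy j) ((hψ j).trans (hbj j)) (abs_nonneg _) (by norm_num)
  have hpart : ∀ N, ∑ i ∈ Finset.range N, |y (i + s) * ψ (i + s) x| ≤
      (p / (2 * (1 - p))) * C * (s : ℝ) ^ (1 - a) := by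
    intro N
    have h1 := kl_aux_sum a ha s hs N
    have h2 : 0 ≤ ((N + s : ℕ) : ℝ) ^ (1 - a) := by positivity
    have h3 : ∑ i ∈ Finset.range N, (((i + s : ℕ) : ℝ) + 1) ^ (-a) ≤
        (s : ℝ) ^ (1 - a) / (a - 1) := by
      rw [le_div_iff₀ (by linarith)]; linarith
    have h4 : p / (2 * (1 - p)) = 1 / 2 * (1 / (a - 1)) := by
      have : (1 - p) ≠ 0 := by linarith
      have h5 : a - 1 = (1 - p) / p := by rw [hadef]; field_simp
      rw [h5]; field_simp
    calc _ ≤ ∑ i ∈ Finset.range N, 1 / 2 * (C * (((i + s : ℕ) : ℝ) + 1) ^ (-a)) :=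
          Finset.sum_le_sum fun i _ => hterm (i + s)
      _ = 1 / 2 * C * ∑ i ∈ Finset.range N, (((i + s : ℕ) : ℝ) + 1) ^ (-a) := by
          rw [Finset.mul_sum]; exact Finset.sum_congr rfl fun i _ => by ring
      _ ≤ 1 / 2 * C * ((s : ℝ) ^ (1 - a) / (a - 1)) := by gcongr
      _ = _ := by rw [h4]; ring
  have hsabs : Summable fun i => |y (i + s) * ψ (i + s) x| :=
    summable_of_sum_range_le (fun _ => abs_nonneg _) hpart
  have hs' : Summable fun j => y j * ψ j x :=
    (summable_nat_add_iff s).1 hsabs.of_abs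
  have hfin : ∑' j : ℕ, (if j < s then y j else 0) * ψ j x =
      ∑ j ∈ Finset.range s, y j * ψ j x := by
    rw [tsum_eq_sum (s := Finset.range s)]
    · refine Finset.sum_congr rfl fun j hj => ?_
      rw [if_pos (Finset.mem_range.1 hj)]
    · intro j hj
      rw [if_neg (fun h => hj (Finset.mem_range.2 h)), zero_mul]
  rw [hfin, ← hs'.sum_add_tsum_nat_add s]
  have e : ∀ u v w : ℝ, u + (v + w) - (u + v) = w := fun u v w => by ring
  rw [e]
  calc _ ≤ ∑' i, |y (i + s) * ψ (i + s) x| := by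
        simpa only [Real.norm_eq_abs] using norm_tsum_le_tsum_norm (f := fun i => y (i + s) * ψ (i + s) x) hsabs
    _ ≤ _ := Real.tsum_le_of_sum_range_le (fun _ => abs_nonneg _) hpart
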